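/- arXiv:2605.26402 — 2 statements merged into one kernel-verified Lean document; each statement's English description precedes it below -/
import Mathlib

section
/- Assume Condition (A) holds with order τ > −1/2. Fix constants C, θ, B > 0 and let I = [a, b) ⊆ [1 − B/n, 1) be an interval with enlargement J ⊇ I, and suppose M_n is dominated by R_n on J with factor function φ(x) = C·x^θ, i.e., |M_n(x)| ≤ φ(1−|x|+1/n)·√(Var[R_n(x)]) for x ∈ J ∩ [−1,1] and |M_n^*(1/x)| ≤ φ(1−|1/x|+1/n)·√(Var[R_n^*(1/x)]) for x ∈ J ∖ [−1,1]. Then there exists a constant c > 0 such that for all sufficiently large n and every integer k ≥ 0: sup_{u ∈ [a,b]} |M_n^{(k)}(u)| ≤ c^k·k!·(1−b+1/n)^{−k}·√(Var[R_n(b)]). -/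
/-!
Derivative bounds for the deterministic part: if `M_n` is dominated by `R_n` on an
enlargement `J` of `I = [a, b) ⊆ [1 − B/n, 1)` with factor function `C·x^θ`, then
`sup_{u ∈ [a,b]} |M_n^{(k)}(u)| ≤ c^k k! (1 − b + 1/n)^{−k} √(Var[R_n(b)])`.
-/

open Filter Polynomial

/-- The deterministic part `M_n(x) = ∑_{j=0}^n m_j x^j`. -/
noncomputable def Mpoly (m : ℕ → ℝ) (n : ℕ) : Polynomial ℝ :=
  ∑ j ∈ Finset.range (n + 1), Polynomial.C (m j) * Polynomial.X ^ j

/-- `Var[R_n(x)] = ∑_{j=0}^n v_j² x^{2j}`. -/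
noncomputable def VarR (v : ℕ → ℝ) (n : ℕ) (x : ℝ) : ℝ :=
  ∑ j ∈ Finset.range (n + 1), v j ^ 2 * x ^ (2 * j)

/-- `Var[R_n^*(x)] = ∑_{j=0}^n v_{n−j}² x^{2j}`. -/
noncomputable def VarRstar (v : ℕ → ℝ) (n : ℕ) (x : ℝ) : ℝ :=
  ∑ j ∈ Finset.range (n + 1), v (n - j) ^ 2 * x ^ (2 * j)

/-- `[a', b']` is an enlargement of an interval with endpoints `a < b`. -/
def IsEnlargement (n : ℕ) (a b a' b' c₁ c₂ : ℝ) : Prop :=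
  c₁ * ((abs (1 - |a|)) + 1 / (n : ℝ)) ≤ a - a' ∧
  a - a' ≤ c₂ * ((abs (1 - |a|)) + 1 / (n : ℝ)) ∧
  c₁ * ((abs (1 - |b|)) + 1 / (n : ℝ)) ≤ b' - b ∧
  b' - b ≤ c₂ * ((abs (1 - |b|)) + 1 / (n : ℝ))

/-- The product of the distances from `i` to the other points of `{0, …, N}`. -/
lemma prod_erase_abs_sub (N i : ℕ) (hi : i ≤ N) :
    ∏ j ∈ (Finset.range (N + 1)).erase i, |(i : ℝ) - j| = (i.factorial * (N - i).factorial : ℕ) := by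
  have hset : (Finset.range (N + 1)).erase i = Finset.range i ∪ Finset.Ico (i + 1) (N + 1) := by
    ext j
    simp only [Finset.mem_erase, Finset.mem_range, Finset.mem_union, Finset.mem_Ico]
    omega
  have hdisj : Disjoint (Finset.range i) (Finset.Ico (i + 1) (N + 1)) := by
    rw [Finset.disjoint_left]
    intro j h1 h2
    simp only [Finset.mem_range, Finset.mem_Ico] at h1 h2
    omega
  rw [hset, Finset.prod_union hdisj, Nat.cast_mul]
  congr 1
  · rw [← Finset.prod_range_add_one_eq_factorial, ← Finset.prod_range_reflect, Nat.cast_prod]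
    refine Finset.prod_congr rfl fun j hj => ?_
    have hj' := Finset.mem_range.1 hj
    have : (i : ℝ) = (i - 1 - j : ℕ) + (j + 1 : ℕ) := by
      rw [← Nat.cast_add]; congr 1; omega
    rw [this, add_sub_cancel_left, Nat.abs_cast]
  · rw [← Finset.prod_range_add_one_eq_factorial, Finset.prod_Ico_eq_prod_range, Nat.cast_prod]
    have : N + 1 - (i + 1) = N - i := by omega
    rw [this]
    refine Finset.prod_congr rfl fun j _ => ?_
    push_cast
    rw [abs_sub_comm, abs_of_nonneg] <;> linarith [(Nat.cast_nonneg j : (0 : ℝ) ≤ j)]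

lemma abs_coeff_prod_X_sub_C_le {ι : Type*} (S : Finset ι) (y : ι → ℝ)
    (hy : ∀ i ∈ S, |y i| ≤ 1) (k : ℕ) :
    |(∏ i ∈ S, (X - C (y i))).coeff k| ≤ 2 ^ S.card := by
  classical
  induction S using Finset.induction_on generalizing k with
  | empty =>
    simp only [Finset.prod_empty, Finset.card_empty, pow_zero, coeff_one]
    split_ifs <;> simp
  | insert a S ha ih =>
    rw [Finset.prod_insert ha, Finset.card_insert_of_notMem ha, sub_mul, coeff_sub, coeff_C_mul]
    have ih' := ih fun i hi => hy i (Finset.mem_insert_of_mem hi)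
    have h1 : |(X * ∏ i ∈ S, (X - C (y i))).coeff k| ≤ 2 ^ S.card := by
      cases k with
      | zero => simp
      | succ k => rw [coeff_X_mul]; exact ih' k
    have h2 : |y a * (∏ i ∈ S, (X - C (y i))).coeff k| ≤ 2 ^ S.card := by
      rw [abs_mul]
      calc _ ≤ 1 * 2 ^ S.card :=
            mul_le_mul (hy a (Finset.mem_insert_self _ _)) (ih' k) (abs_nonneg _) zero_le_one
        _ = _ := one_mul _
    calc _ ≤ _ := abs_sub _ _
      _ ≤ 2 ^ S.card + 2 ^ S.card := add_le_add h1 h2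
      _ = _ := by ring

/-- The coefficients of the Lagrange basis polynomials for equispaced nodes in `[0, 1]` grow
at most exponentially in the number of nodes. -/
lemma abs_coeff_lagrange_basis_le (N i k : ℕ) (hi : i ≤ N) :
    |(Lagrange.basis (Finset.range (N + 1)) (fun j : ℕ => (j : ℝ) / (N + 1 : ℕ)) i).coeff k|
      ≤ (4 * Real.exp 1) ^ (N + 1) := by
  have hN : (0 : ℝ) < (N + 1 : ℕ) := by positivity
  have hcard : ((Finset.range (N + 1)).erase i).card = N := by
    rw [Finset.card_erase_of_mem (Finset.mem_range.2 (by omega))]; simp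
  unfold Lagrange.basis Lagrange.basisDivisor
  rw [Finset.prod_mul_distrib, ← map_prod, coeff_C_mul, abs_mul, Finset.abs_prod]
  have h1 := abs_coeff_prod_X_sub_C_le ((Finset.range (N + 1)).erase i)
    (fun j : ℕ => (j : ℝ) / (N + 1 : ℕ)) (fun j hj => by
      have : j < N + 1 := Finset.mem_range.1 (Finset.mem_of_mem_erase hj)
      rw [abs_of_nonneg (by positivity), div_le_one hN]
      exact_mod_cast this.le) k
  rw [hcard] at h1
  have h2 : ∏ j ∈ (Finset.range (N + 1)).erase i,
      |((i : ℝ) / (N + 1 : ℕ) - (j : ℝ) / (N + 1 : ℕ))⁻¹|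
      = ((N + 1 : ℕ) : ℝ) ^ N / (i.factorial * (N - i).factorial : ℕ) := by
    have hpow : ((N + 1 : ℕ) : ℝ) ^ N
        = ∏ _j ∈ (Finset.range (N + 1)).erase i, ((N + 1 : ℕ) : ℝ) := by
      rw [Finset.prod_const, hcard]
    rw [← prod_erase_abs_sub N i hi, hpow, ← Finset.prod_div_distrib]
    refine Finset.prod_congr rfl fun j _ => ?_
    rw [← sub_div, abs_inv, abs_div, abs_of_pos hN, inv_div]
  have h3 : ((N + 1 : ℕ) : ℝ) ^ N / (i.factorial * (N - i).factorial : ℕ)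
      ≤ 2 ^ N * Real.exp 1 ^ (N + 1) := by
    have hch : ((N.choose i : ℕ) : ℝ) ≤ 2 ^ N := by
      exact_mod_cast Nat.choose_le_two_pow N i
    have hfac : ((i.factorial * (N - i).factorial : ℕ) : ℝ) * N.choose i = N.factorial := by
      rw [← Nat.choose_mul_factorial_mul_factorial hi]; push_cast; ring
    have hexp : ((N + 1 : ℕ) : ℝ) ^ N / N.factorial ≤ Real.exp 1 ^ (N + 1) := by
      rw [← Real.exp_nat_mul, mul_one]
      exact Real.pow_div_factorial_le_exp _ hN.le N
    have hf : (0 : ℝ) < (i.factorial * (N - i).factorial : ℕ) := by positivity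
    have hc : (0 : ℝ) < (N.choose i : ℕ) := by exact_mod_cast Nat.choose_pos hi
    calc _ = (N.choose i : ℝ) * (((N + 1 : ℕ) : ℝ) ^ N / N.factorial) := by
          rw [← hfac]; field_simp
      _ ≤ _ := mul_le_mul hch hexp (by positivity) (by positivity)
  rw [h2]
  calc _ ≤ (2 ^ N * Real.exp 1 ^ (N + 1)) * 2 ^ N :=
        mul_le_mul h3 h1 (abs_nonneg _) (by positivity)
    _ = 4 ^ N * Real.exp 1 ^ (N + 1) := by
        rw [show (4 : ℝ) = 2 * 2 by norm_num, mul_pow]; ring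
    _ ≤ 4 ^ (N + 1) * Real.exp 1 ^ (N + 1) := by
        gcongr
        · norm_num
        · omega
    _ = _ := (mul_pow _ _ _).symm

/-- A polynomial of degree less than `K` bounded by `η` at `K` equispaced points of `[0, 1]`
has coefficients bounded by `(8e)^K η`. -/
lemma abs_coeff_le_of_abs_eval_le (K : ℕ) (hK : 1 ≤ K) (Q : ℝ[X]) (hQ : Q.degree < K) (η : ℝ)
    (h : ∀ x ∈ Set.Icc (0 : ℝ) 1, |Q.eval x| ≤ η) (k : ℕ) :
    |Q.coeff k| ≤ (8 * Real.exp 1) ^ K * η := by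
  obtain ⟨N, rfl⟩ : ∃ N, K = N + 1 := ⟨K - 1, by omega⟩
  have hN : (0 : ℝ) < (N + 1 : ℕ) := by positivity
  have hη : 0 ≤ η := (abs_nonneg _).trans (h 0 (by simp))
  have hinj : Set.InjOn (fun j : ℕ => (j : ℝ) / (N + 1 : ℕ)) (Finset.range (N + 1) : Finset ℕ) := by
    intro i _ j _ hij
    exact_mod_cast (div_left_inj' hN.ne').1 hij
  rw [Lagrange.eq_interpolate hinj (f := Q) (by simpa using hQ), Lagrange.interpolate_apply,
    finsetSum_coeff]
  calc _ ≤ _ := Finset.abs_sum_le_sum_abs _ _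
    _ ≤ ∑ i ∈ Finset.range (N + 1), η * (4 * Real.exp 1) ^ (N + 1) := by
        refine Finset.sum_le_sum fun i hi => ?_
        have hi' := Finset.mem_range.1 hi
        rw [coeff_C_mul, abs_mul]
        refine mul_le_mul (h _ ⟨by positivity, ?_⟩)
          (abs_coeff_lagrange_basis_le N i k (by omega)) (abs_nonneg _) hη
        rw [div_le_one hN]
        exact_mod_cast hi'.le
    _ = ((N + 1 : ℕ) : ℝ) * (η * (4 * Real.exp 1) ^ (N + 1)) := by simp
    _ ≤ 2 ^ (N + 1) * (η * (4 * Real.exp 1) ^ (N + 1)) := by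
        gcongr
        exact_mod_cast (Nat.lt_two_pow_self (n := N + 1)).le
    _ = _ := by
        rw [show (8 : ℝ) * Real.exp 1 = 2 * (4 * Real.exp 1) by ring, mul_pow 2]; ring

/-- Choice of a scale `s` and of a truncation degree `K` of order `log n`. -/
lemma exists_scale_and_truncation (R p θ D s₀ : ℝ) (hR : 1 < R) (hp : 0 ≤ p) (hθ : 0 < θ)
    (hD : 0 ≤ D) (hs₀ : 0 < s₀) :
    ∃ s : ℝ, 0 < s ∧ s ≤ s₀ ∧ ∀ᶠ n : ℕ in atTop, ∃ K : ℕ, 1 ≤ K ∧ (n : ℝ) ^ p * s ^ K ≤ 1 ∧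
      R ^ K * (D * (n : ℝ) ^ (-θ) + 2 * ((n : ℝ) ^ p * s ^ K)) ≤ 1 := by
  have hR0 : 0 < R := by linarith
  have hlR : 0 < Real.log R := Real.log_pos hR
  set ε := θ / (2 * Real.log R) with hε
  have hε0 : 0 < ε := by positivity
  refine ⟨min s₀ (Real.exp (-(p + θ) / ε)), by positivity, min_le_left _ _, ?_⟩
  set s := min s₀ (Real.exp (-(p + θ) / ε))
  have hs : 0 < s := by positivity
  have hlim : Tendsto (fun n : ℕ => R * (D + 2) * (n : ℝ) ^ (-(θ / 2))) atTop (nhds 0) := by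
    simpa using ((tendsto_rpow_neg_atTop (half_pos hθ)).comp
      tendsto_natCast_atTop_atTop).const_mul (R * (D + 2))
  filter_upwards [hlim.eventually (eventually_le_nhds zero_lt_one), eventually_ge_atTop 1]
    with n hn hn1
  have hn1' : (1 : ℝ) ≤ n := by exact_mod_cast hn1
  have hn0 : (0 : ℝ) < n := by linarith
  have hL : 0 ≤ Real.log n := Real.log_nonneg hn1'
  set K := ⌊ε * Real.log n⌋₊ + 1 with hKdef
  have hKl : ε * Real.log n ≤ K := by
    rw [hKdef]; push_cast; exact (Nat.lt_floor_add_one _).le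
  have hKu : (K : ℝ) ≤ ε * Real.log n + 1 := by
    rw [hKdef]; push_cast
    linarith [Nat.floor_le (by positivity : 0 ≤ ε * Real.log n)]
  have hRK : R ^ K ≤ R * (n : ℝ) ^ (θ / 2) := by
    rw [← Real.rpow_natCast]
    calc R ^ (K : ℝ) ≤ R ^ (ε * Real.log n + 1) := Real.rpow_le_rpow_of_exponent_le hR.le hKu
      _ = R * (n : ℝ) ^ (θ / 2) := by
        rw [Real.rpow_add hR0, Real.rpow_one, mul_comm, Real.rpow_def_of_pos hR0,
          Real.rpow_def_of_pos hn0]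
        congr 2
        rw [hε]; field_simp
  have hsK : s ^ K ≤ (n : ℝ) ^ (-(p + θ)) := by
    calc s ^ K ≤ Real.exp (-(p + θ) / ε) ^ K := pow_le_pow_left₀ hs.le (min_le_right _ _) K
      _ = Real.exp (-((p + θ) / ε * K)) := by rw [← Real.exp_nat_mul]; congr 1; ring
      _ ≤ Real.exp (-((p + θ) / ε * (ε * Real.log n))) := by gcongr
      _ = _ := by rw [Real.rpow_def_of_pos hn0]; congr 1; field_simp
  have hnp : (n : ℝ) ^ p * s ^ K ≤ (n : ℝ) ^ (-θ) := by
    calc _ ≤ (n : ℝ) ^ p * (n : ℝ) ^ (-(p + θ)) := by gcongr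
      _ = _ := by rw [← Real.rpow_add hn0]; congr 1; ring
  refine ⟨K, by omega, hnp.trans (Real.rpow_le_one_of_one_le_of_nonpos hn1' (by linarith)), ?_⟩
  calc _ ≤ R * (n : ℝ) ^ (θ / 2) * (D * (n : ℝ) ^ (-θ) + 2 * (n : ℝ) ^ (-θ)) := by gcongr
    _ = R * (D + 2) * ((n : ℝ) ^ (θ / 2) * (n : ℝ) ^ (-θ)) := by ring
    _ = R * (D + 2) * (n : ℝ) ^ (-(θ / 2)) := by
        rw [← Real.rpow_add hn0]; congr 2; ring
    _ ≤ 1 := hn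

/-- If the coefficients of `T` satisfy `|t_j| ≤ G r^j A` and `T` is at most `E A` on
`[-s / r, 0]`, then `|t_j| ≤ (r / s)^j A`, provided that some truncation degree `K` balances the
loss `G` against the gain `E`. -/
lemma abs_coeff_le_of_truncation (T : ℝ[X]) (K : ℕ) (hK : 1 ≤ K) (r s G E A : ℝ) (hr : 0 < r)
    (hs : 0 < s) (hs2 : s ≤ 1 / 2) (hG : 0 ≤ G) (hA : 0 ≤ A) (hGs : G * s ^ K ≤ 1)
    (hKE : (8 * Real.exp 1) ^ K * (E + 2 * (G * s ^ K)) ≤ 1)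
    (hcoeff : ∀ j, |T.coeff j| ≤ G * r ^ j * A)
    (heval : ∀ h ∈ Set.Icc 0 (s / r), |T.eval (-h)| ≤ E * A) (j : ℕ) :
    |T.coeff j| ≤ (r / s) ^ j * A := by
  rcases lt_or_ge j K with hj | hj
  · set Q : ℝ[X] := ∑ i ∈ Finset.range K, C (T.coeff i * (-(s / r)) ^ i) * X ^ i with hQ
    have hQcoeff : Q.coeff j = T.coeff j * (-(s / r)) ^ j := by
      rw [hQ, finsetSum_coeff, Finset.sum_eq_single_of_mem j (Finset.mem_range.2 hj)]
      · rw [coeff_C_mul_X_pow, if_pos rfl]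
      · intro i _ hij
        rw [coeff_C_mul_X_pow, if_neg hij.symm]
    have hQdeg : Q.degree < K := by
      rw [hQ, degree_lt_iff_coeff_zero]
      intro i hi
      rw [finsetSum_coeff]
      refine Finset.sum_eq_zero fun l hl => ?_
      have := Finset.mem_range.1 hl
      rw [coeff_C_mul, coeff_X_pow, if_neg (by omega), mul_zero]
    have hQeval : ∀ x ∈ Set.Icc (0 : ℝ) 1, |Q.eval x| ≤ (E + 2 * (G * s ^ K)) * A := by
      rintro x ⟨hx0, hx1⟩
      have hd : T.natDegree < K + (T.natDegree + 1) := by omega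
      have hT := eval_eq_sum_range' hd (-(s / r * x))
      rw [Finset.sum_range_add] at hT
      have hQx : Q.eval x = ∑ i ∈ Finset.range K, T.coeff i * (-(s / r * x)) ^ i := by
        rw [hQ, eval_finsetSum]
        refine Finset.sum_congr rfl fun i _ => ?_
        rw [eval_mul, eval_C, eval_pow, eval_X, mul_assoc, ← mul_pow, neg_mul]
      rw [← hQx] at hT
      have htail : |∑ i ∈ Finset.range (T.natDegree + 1),
          T.coeff (K + i) * (-(s / r * x)) ^ (K + i)| ≤ 2 * (G * s ^ K) * A := by
        calc _ ≤ _ := Finset.abs_sum_le_sum_abs _ _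
          _ ≤ ∑ i ∈ Finset.range (T.natDegree + 1), G * s ^ K * A * (1 / 2) ^ i := by
            refine Finset.sum_le_sum fun i _ => ?_
            rw [abs_mul, abs_pow, abs_neg, abs_of_nonneg (by positivity : 0 ≤ s / r * x)]
            calc _ ≤ G * r ^ (K + i) * A * (s / r) ^ (K + i) := by
                  refine mul_le_mul (hcoeff _) ?_ (by positivity) (by positivity)
                  exact pow_le_pow_left₀ (by positivity)
                    (mul_le_of_le_one_right (by positivity) hx1) _
              _ = G * s ^ K * A * s ^ i := by
                  rw [div_pow, pow_add s]; field_simp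
              _ ≤ _ := by gcongr
          _ = G * s ^ K * A * ∑ i ∈ Finset.range (T.natDegree + 1), (1 / 2 : ℝ) ^ i := by
            rw [Finset.mul_sum]
          _ ≤ G * s ^ K * A * 2 := by
            gcongr
            exact sum_geometric_two_le _
          _ = _ := by ring
      have hTx := heval (s / r * x)
        ⟨by positivity, mul_le_of_le_one_right (by positivity) hx1⟩
      have : Q.eval x = T.eval (-(s / r * x)) - ∑ i ∈ Finset.range (T.natDegree + 1),
          T.coeff (K + i) * (-(s / r * x)) ^ (K + i) := by rw [hT]; ring
      rw [this]
      calc _ ≤ _ := abs_sub _ _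
        _ ≤ E * A + 2 * (G * s ^ K) * A := add_le_add hTx htail
        _ = _ := by ring
    have h1 := abs_coeff_le_of_abs_eval_le K hK Q hQdeg _ hQeval j
    rw [hQcoeff, abs_mul, abs_pow, abs_neg, abs_of_pos (by positivity : 0 < s / r)] at h1
    have h2 : |T.coeff j| * (s / r) ^ j ≤ A := by
      calc _ ≤ _ := h1
        _ = ((8 * Real.exp 1) ^ K * (E + 2 * (G * s ^ K))) * A := by ring
        _ ≤ 1 * A := by gcongr
        _ = A := one_mul A
    calc _ = (r / s) ^ j * (|T.coeff j| * (s / r) ^ j) := by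
          rw [div_pow, div_pow]; field_simp
      _ ≤ _ := by gcongr
  · have hGj : G * s ^ j ≤ 1 :=
      (mul_le_mul_of_nonneg_left (pow_le_pow_of_le_one hs.le (by linarith) hj) hG).trans hGs
    calc _ ≤ _ := hcoeff j
      _ = (G * s ^ j) * ((r / s) ^ j * A) := by rw [div_pow]; field_simp
      _ ≤ 1 * ((r / s) ^ j * A) := by gcongr
      _ = _ := one_mul _

lemma natDegree_Mpoly_le (m : ℕ → ℝ) (n : ℕ) : (Mpoly m n).natDegree ≤ n :=
  natDegree_sum_le_of_forall_le _ _ fun i hi =>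
    (natDegree_C_mul_X_pow_le _ _).trans (by have := Finset.mem_range.1 hi; omega)

lemma VarR_mono (v : ℕ → ℝ) (n : ℕ) {x y : ℝ} (hx : 0 ≤ x) (hxy : x ≤ y) :
    VarR v n x ≤ VarR v n y :=
  Finset.sum_le_sum fun j _ => by gcongr

lemma abs_coeff_taylor_Mpoly_le (m : ℕ → ℝ) (n : ℕ) (W u : ℝ) (hm : ∀ i ≤ n, |m i| ≤ W)
    (hu0 : 0 ≤ u) (hu1 : u ≤ 1) (j : ℕ) :
    |(taylor u (Mpoly m n)).coeff j| ≤ (n + 1) * W * (n : ℝ) ^ j := by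
  have hW : 0 ≤ W := (abs_nonneg _).trans (hm 0 (Nat.zero_le _))
  rw [taylor_coeff, Mpoly, map_sum, eval_finsetSum]
  calc _ ≤ _ := Finset.abs_sum_le_sum_abs _ _
    _ ≤ ∑ i ∈ Finset.range (n + 1), W * (n : ℝ) ^ j := by
        refine Finset.sum_le_sum fun i hi => ?_
        have hi' : i ≤ n := by have := Finset.mem_range.1 hi; omega
        rw [C_mul_X_pow_eq_monomial, hasseDeriv_monomial, eval_monomial, abs_mul, abs_mul,
          abs_of_nonneg (pow_nonneg hu0 _), Nat.abs_cast]
        have h1 : ((i.choose j : ℕ) : ℝ) ≤ (n : ℝ) ^ j := by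
          exact_mod_cast (Nat.choose_le_pow i j).trans (Nat.pow_le_pow_left hi' j)
        calc _ ≤ ((n : ℝ) ^ j * W) * 1 := by
              gcongr
              · exact hm i hi'
              · exact pow_le_one₀ hu0 hu1
          _ = _ := by ring
    _ = _ := by simp; ring

theorem deterministic_derivative_bounds
    (m v : ℕ → ℝ) (τ ε₀ C₀ : ℝ) (N₀ : ℕ)
    (hτ : -1/2 < τ) (hε₀ : 0 < ε₀) (hC₀ : 0 < C₀)
    (hA2m : ∀ j, |m j| ≤ C₀ * (1 + (j : ℝ)) ^ τ)
    (hA2v : ∀ j, |v j| ≤ C₀ * (1 + (j : ℝ)) ^ τ)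
    (hA3 : ∀ j, N₀ ≤ j → (1 + (j : ℝ)) ^ τ / C₀ ≤ |v j|)
    (C θ B : ℝ) (hC : 0 < C) (hθ : 0 < θ) (hB : 0 < B)
    (a b a' b' : ℕ → ℝ)
    (hsub : ∀ n : ℕ, 1 ≤ n → 1 - B / (n : ℝ) ≤ a n ∧ a n < b n ∧ b n ≤ 1)
    (c₁ c₂ : ℝ) (hc₁ : 0 < c₁) (hc₂ : 0 < c₂)
    (henl : ∀ n : ℕ, 1 ≤ n → IsEnlargement n (a n) (b n) (a' n) (b' n) c₁ c₂)
    (hdom : ∀ n : ℕ, 1 ≤ n →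
      (∀ x ∈ Set.Icc (a' n) (b' n) ∩ Set.Icc (-1 : ℝ) 1,
        |Polynomial.eval x (Mpoly m n)|
          ≤ C * (1 - |x| + 1 / (n : ℝ)) ^ θ * Real.sqrt (VarR v n x)) ∧
      (∀ x ∈ Set.Icc (a' n) (b' n) \ Set.Icc (-1 : ℝ) 1,
        |Polynomial.eval (1 / x) (Polynomial.reflect n (Mpoly m n))|
          ≤ C * (1 - |1 / x| + 1 / (n : ℝ)) ^ θ * Real.sqrt (VarRstar v n (1 / x)))) :
    ∃ c : ℝ, 0 < c ∧
      ∀ᶠ n : ℕ in atTop, ∀ k : ℕ, ∀ u ∈ Set.Icc (a n) (b n),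
        |Polynomial.eval u (Polynomial.derivative^[k] (Mpoly m n))|
          ≤ c ^ k * (k.factorial : ℝ) * (1 - b n + 1 / (n : ℝ)) ^ (-(k : ℝ)) *
              Real.sqrt (VarR v n (b n)) := by
  set D : ℝ := C * (B + 2) ^ θ with hD
  have hvN : 0 < |v N₀| := lt_of_lt_of_le (by positivity) (hA3 N₀ le_rfl)
  set σ : ℝ := |v N₀| * (1 / 2) ^ N₀ with hσ
  have hσ0 : 0 < σ := by positivity
  have he : 1 < 8 * Real.exp 1 := by linarith [Real.add_one_le_exp (1 : ℝ)]
  obtain ⟨s, hs, hs₀, hev⟩ := exists_scale_and_truncation (8 * Real.exp 1) (|τ| + 2) θ D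
    (min c₁ (1 / 2)) he (by positivity) hθ (by positivity) (by positivity)
  have hsc : s ≤ c₁ := hs₀.trans (min_le_left _ _)
  have hs2 : s ≤ 1 / 2 := hs₀.trans (min_le_right _ _)
  refine ⟨(B + 1) / s, by positivity, ?_⟩
  filter_upwards [hev, eventually_ge_atTop 1, eventually_ge_atTop N₀,
    eventually_ge_atTop ⌈2 * (B + 1)⌉₊, eventually_ge_atTop ⌈C₀ * 2 ^ (|τ| + 1) / σ⌉₊]
    with n ⟨K, hK, hGs, hKE⟩ hn1 hnN hnB hnσ k u ⟨hau, hub⟩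
  have hn1' : (1 : ℝ) ≤ n := by exact_mod_cast hn1
  have hn0 : (0 : ℝ) < n := by linarith
  have hnB' : 2 * (B + 1) ≤ n := Nat.ceil_le.1 hnB
  have hnσ' : C₀ * 2 ^ (|τ| + 1) / σ ≤ n := Nat.ceil_le.1 hnσ
  obtain ⟨haB, hab, hb1⟩ := hsub n hn1
  obtain ⟨hea, -, heb, -⟩ := henl n hn1
  have hBn : (B + 1) / n ≤ 1 / 2 := by rw [div_le_iff₀ hn0]; linarith
  have hBn' : (B + 1) / n = B / n + 1 / n := add_div _ _ _
  have hinv : 0 < 1 / (n : ℝ) := by positivity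
  have hb2 : 1 / 2 ≤ b n := by linarith
  have ha2 : a' n ≤ a n - c₁ / n := by
    have : c₁ * (1 / n) ≤ c₁ * (abs (1 - |a n|) + 1 / n) := by
      gcongr; linarith [abs_nonneg (1 - |a n|)]
    rw [div_eq_mul_one_div]
    linarith
  have hb' : b n ≤ b' n := by
    have : 0 ≤ c₁ * (abs (1 - |b n|) + 1 / n) := by positivity
    linarith
  set A := Real.sqrt (VarR v n (b n)) with hA
  have hσA : σ ≤ A := by
    refine Real.le_sqrt_of_sq_le ?_
    calc σ ^ 2 = v N₀ ^ 2 * (1 / 2) ^ (2 * N₀) := by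
          rw [hσ, mul_pow, sq_abs, ← pow_mul, mul_comm N₀]
      _ ≤ v N₀ ^ 2 * (b n) ^ (2 * N₀) := by gcongr
      _ ≤ _ := Finset.single_le_sum (f := fun j => v j ^ 2 * (b n) ^ (2 * j))
          (fun j _ => by positivity) (Finset.mem_range.2 (by omega))
  have hA0 : 0 ≤ A := Real.sqrt_nonneg _
  have hu1 : u ≤ 1 := hub.trans hb1
  have hcoeff : ∀ j, |(taylor u (Mpoly m n)).coeff j| ≤ (n : ℝ) ^ (|τ| + 2) * (n : ℝ) ^ j * A := by
    intro j
    have hm : ∀ i ≤ n, |m i| ≤ C₀ * (1 + (n : ℝ)) ^ |τ| := by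
      intro i hi
      refine (hA2m i).trans ?_
      gcongr
      calc (1 + (i : ℝ)) ^ τ ≤ (1 + (i : ℝ)) ^ |τ| :=
            Real.rpow_le_rpow_of_exponent_le (by linarith [(Nat.cast_nonneg i : (0 : ℝ) ≤ i)])
              (le_abs_self τ)
        _ ≤ _ := by gcongr
    refine (abs_coeff_taylor_Mpoly_le m n _ u hm (by linarith) hu1 j).trans ?_
    have h1 : ((n : ℝ) + 1) * (C₀ * (1 + (n : ℝ)) ^ |τ|) ≤ (n : ℝ) ^ (|τ| + 2) * A := by
      calc _ = C₀ * (1 + (n : ℝ)) ^ (|τ| + 1) := by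
            rw [Real.rpow_add_one (by positivity)]; ring
        _ ≤ C₀ * (2 * (n : ℝ)) ^ (|τ| + 1) := by gcongr; linarith
        _ = (C₀ * 2 ^ (|τ| + 1)) * (n : ℝ) ^ (|τ| + 1) := by
            rw [Real.mul_rpow (by norm_num) hn0.le]; ring
        _ ≤ (n * σ) * (n : ℝ) ^ (|τ| + 1) := by
            exact mul_le_mul_of_nonneg_right ((div_le_iff₀ hσ0).1 hnσ') (by positivity)
        _ = (n : ℝ) ^ (|τ| + 2) * σ := by
            rw [show |τ| + 2 = (|τ| + 1) + 1 by ring, Real.rpow_add_one hn0.ne' (|τ| + 1)]; ring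
        _ ≤ _ := by gcongr
    calc _ ≤ ((n : ℝ) ^ (|τ| + 2) * A) * (n : ℝ) ^ j := by gcongr
      _ = _ := by ring
  have heval : ∀ h ∈ Set.Icc 0 (s / (n : ℝ)),
      |(taylor u (Mpoly m n)).eval (-h)| ≤ D * (n : ℝ) ^ (-θ) * A := by
    rintro h ⟨hh0, hh1⟩
    rw [taylor_eval]
    set x := -h + u with hx
    have hsn : s / (n : ℝ) ≤ c₁ / n := by gcongr
    have hsn2 : s / (n : ℝ) ≤ 1 / n := by gcongr; linarith
    have hx0 : 0 ≤ x := by linarith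
    have hxb : x ≤ b n := by linarith
    have hd := (hdom n hn1).1 x ⟨⟨by linarith, by linarith⟩, by linarith, by linarith⟩
    rw [abs_of_nonneg hx0] at hd
    refine hd.trans ?_
    have hx2 : 1 - x + 1 / (n : ℝ) ≤ (B + 2) / n := by
      rw [show (B + 2) / (n : ℝ) = B / n + 1 / n + 1 / n by ring]; linarith
    have hxp : 0 ≤ 1 - x + 1 / (n : ℝ) := by linarith
    have h2 : (1 - x + 1 / (n : ℝ)) ^ θ ≤ (B + 2) ^ θ * (n : ℝ) ^ (-θ) := by
      calc _ ≤ ((B + 2) / n) ^ θ := Real.rpow_le_rpow hxp hx2 hθ.le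
        _ = _ := by
          rw [Real.div_rpow (by positivity) hn0.le, Real.rpow_neg hn0.le, div_eq_mul_inv]
    calc _ ≤ C * ((B + 2) ^ θ * (n : ℝ) ^ (-θ)) * A := by
          gcongr
          exact Real.sqrt_le_sqrt (VarR_mono v n hx0 hxb)
      _ = _ := by rw [hD]; ring
  have hmain := abs_coeff_le_of_truncation (taylor u (Mpoly m n)) K hK n s _ _ A hn0 hs hs2
    (by positivity) hA0 hGs hKE hcoeff heval k
  have hder : eval u (derivative^[k] (Mpoly m n))
      = k.factorial * (taylor u (Mpoly m n)).coeff k := by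
    rw [taylor_coeff, ← factorial_smul_hasseDeriv]
    simp
  have hδ : 0 < 1 - b n + 1 / (n : ℝ) := by linarith
  rw [hder, abs_mul, Nat.abs_cast, Real.rpow_neg hδ.le, Real.rpow_natCast]
  have hratio : (n : ℝ) / s ≤ (B + 1) / s * (1 - b n + 1 / (n : ℝ))⁻¹ := by
    rw [← div_eq_mul_inv, le_div_iff₀ hδ, div_mul_eq_mul_div]
    gcongr
    calc _ ≤ (n : ℝ) * ((B + 1) / n) := by gcongr; linarith
      _ = _ := by field_simp
  calc _ ≤ k.factorial * (((B + 1) / s * (1 - b n + 1 / (n : ℝ))⁻¹) ^ k * A) := by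
        gcongr
        exact hmain.trans (by gcongr)
    _ = _ := by rw [mul_pow, inv_pow]; ring
end

section
/- Let k ≥ 1 be an integer, let a < b be real numbers, and let P : ℝ → ℝ be a polynomial having at least k roots in the interval [a, b), counted with multiplicity. Then |P(b)| ≤ ∫_a^b ∫_a^{y₁} ⋯ ∫_a^{y_{k−1}} |P^{(k)}(y_k)| dy_k ⋯ dy₂ dy₁, where P^{(k)} denotes the k-th derivative of P. -/
/-!
If a real polynomial has at least `k` roots (with multiplicity) in `[a, b)`, then
`|P(b)|` is bounded by the `k`-fold iterated integral of `|P^{(k)}|` from `a`.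
-/

open Polynomial intervalIntegral

/-- The `k`-fold iterated integral `∫_a^y ∫_a^{y₁} ⋯ ∫_a^{y_{k−1}} g(y_k) dy_k ⋯ dy₁`. -/
noncomputable def iterInt (a : ℝ) (g : ℝ → ℝ) : ℕ → ℝ → ℝ
  | 0, y => g y
  | k + 1, y => ∫ t in a..y, iterInt a g k t

/-- **Rolle's theorem** on an order-connected set: the number of roots in `s` of a real polynomial
(counted with multiplicities) is at most one more than that of its derivative. -/
theorem card_filter_roots_le_derivative (p : ℝ[X]) (s : Set ℝ) [s.OrdConnected]
    [DecidablePred (· ∈ s)] :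
    Multiset.card (p.roots.filter (· ∈ s)) ≤
      Multiset.card ((derivative p).roots.filter (· ∈ s)) + 1 := by
  rcases eq_or_ne (derivative p) 0 with hp' | hp'
  · rw [eq_C_of_derivative_eq_zero hp']
    simp
  have hp : p ≠ 0 := ne_of_apply_ne derivative (by rwa [derivative_zero])
  set M := p.roots.filter (· ∈ s) with hM
  set N := (derivative p).roots.filter (· ∈ s) with hN
  have hsimple : M.toFinset.card ≤ (N.toFinset \ M.toFinset).card + 1 := by
    refine Finset.card_le_sdiff_of_interleaved fun x hx y hy hxy _ => ?_
    rw [Multiset.mem_toFinset, hM, Multiset.mem_filter, mem_roots hp] at hx hy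
    obtain ⟨z, hz, hz0⟩ := exists_deriv_eq_zero hxy p.continuousOn (hx.1.trans hy.1.symm)
    refine ⟨z, ?_, hz⟩
    rw [Multiset.mem_toFinset, hN, Multiset.mem_filter, mem_roots hp', IsRoot, ← p.deriv]
    exact ⟨hz0, Set.OrdConnected.out ‹_› hx.2 hy.2 (Set.Ioo_subset_Icc_self hz)⟩
  have hcount : ∀ x ∈ M.toFinset, M.count x ≤ N.count x + 1 := by
    intro x hx
    rw [Multiset.mem_toFinset, hM, Multiset.mem_filter] at hx
    rw [hM, hN, Multiset.count_filter_of_pos hx.2, Multiset.count_filter_of_pos hx.2,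
      count_roots, count_roots, ← tsub_le_iff_right]
    exact rootMultiplicity_sub_one_le_derivative_rootMultiplicity p x
  calc
    Multiset.card M = ∑ x ∈ M.toFinset, M.count x := (Multiset.toFinset_sum_count_eq _).symm
    _ ≤ ∑ x ∈ M.toFinset, (N.count x + 1) := Finset.sum_le_sum hcount
    _ = ∑ x ∈ M.toFinset, N.count x + M.toFinset.card := by
      rw [Finset.sum_add_distrib, Finset.card_eq_sum_ones]
    _ ≤ ∑ x ∈ M.toFinset, N.count x +
          (∑ x ∈ N.toFinset \ M.toFinset, N.count x + 1) := by
      refine add_le_add_right (hsimple.trans (add_le_add_left ?_ 1)) _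
      rw [Finset.card_eq_sum_ones]
      refine Finset.sum_le_sum fun x hx => ?_
      exact Multiset.one_le_count_iff_mem.2 (Multiset.mem_toFinset.1 (Finset.mem_sdiff.1 hx).1)
    _ = Multiset.card N + 1 := by
      rw [← add_assoc, ← Finset.sum_union Finset.disjoint_sdiff, Finset.union_sdiff_self_eq_union,
        ← Multiset.toFinset_sum_count_eq, ← Finset.sum_subset Finset.subset_union_right]
      intro x _ hx
      simpa only [Multiset.mem_toFinset, Multiset.count_eq_zero] using hx

theorem iterInt_continuous (a : ℝ) {g : ℝ → ℝ} (hg : Continuous g) (k : ℕ) :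
    Continuous (iterInt a g k) := by
  induction k with
  | zero => exact hg
  | succ k ih => exact continuous_primitive (fun _ _ => ih.intervalIntegrable _ _) a

theorem iterInt_nonneg (a : ℝ) {g : ℝ → ℝ} (hg : ∀ x, 0 ≤ g x) (k : ℕ) {y : ℝ} (hy : a ≤ y) :
    0 ≤ iterInt a g k y := by
  induction k generalizing y with
  | zero => exact hg y
  | succ k ih => exact integral_nonneg hy fun t ht => ih ht.1

open scoped Classical in
theorem abs_eval_le_iterInt_of_le_card_roots (k : ℕ) (a b : ℝ) (P : ℝ[X])
    (hroots : k ≤ Multiset.card (P.roots.filter (· ∈ Set.Ico a b))) :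
    |P.eval b| ≤ iterInt a (fun y => |eval y (derivative^[k] P)|) k b := by
  induction k generalizing b P with
  | zero => exact le_rfl
  | succ k ih =>
    set M := P.roots.filter (· ∈ Set.Ico a b) with hM
    have hne : M.toFinset.Nonempty := by
      obtain ⟨x, hx⟩ := Multiset.card_pos_iff_exists_mem.1 (k.succ_pos.trans_le hroots)
      exact ⟨x, Multiset.mem_toFinset.2 hx⟩
    obtain ⟨c, hc, hmax⟩ := M.toFinset.exists_max_image id hne
    rw [Multiset.mem_toFinset, hM, Multiset.mem_filter] at hc
    obtain ⟨hcroot, hac, hcb⟩ := hc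
    have hMle : Multiset.card M ≤ Multiset.card (P.roots.filter (· ∈ Set.Icc a c)) := by
      refine Multiset.card_le_card (Multiset.le_filter.2 ⟨Multiset.filter_le _ _, fun x hx => ?_⟩)
      exact ⟨(Multiset.mem_filter.1 hx).2.1, hmax x (Multiset.mem_toFinset.2 hx)⟩
    have hderiv : k ≤ Multiset.card ((derivative P).roots.filter (· ∈ Set.Icc a c)) :=
      Nat.le_of_succ_le_succ
        ((hroots.trans hMle).trans (card_filter_roots_le_derivative P (Set.Icc a c)))
    rw [Function.iterate_succ_apply]
    set g : ℝ → ℝ := fun y => |eval y (derivative^[k] (derivative P))| with hg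
    have hgc : Continuous (iterInt a g k) :=
      iterInt_continuous a (derivative^[k] (derivative P)).continuous.abs k
    have hbound : ∀ y ∈ Set.Ioo c b, |eval y (derivative P)| ≤ iterInt a g k y := by
      intro y hy
      refine ih y (derivative P) (hderiv.trans (Multiset.card_le_card ?_))
      exact Multiset.monotone_filter_right _ fun x hx => ⟨hx.1, hx.2.trans_lt hy.1⟩
    have hftc : ∫ y in c..b, eval y (derivative P) = P.eval b := by
      rw [integral_eq_sub_of_hasDerivAt (fun x _ => P.hasDerivAt x)
        ((derivative P).continuous.intervalIntegrable _ _), (isRoot_of_mem_roots hcroot).eq_zero,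
        sub_zero]
    calc
      |P.eval b| = |∫ y in c..b, eval y (derivative P)| := by rw [hftc]
      _ ≤ ∫ y in c..b, |eval y (derivative P)| := abs_integral_le_integral_abs hcb.le
      _ ≤ ∫ y in c..b, iterInt a g k y :=
        integral_mono_on_of_le_Ioo hcb.le
          ((derivative P).continuous.abs.intervalIntegrable _ _)
          (hgc.intervalIntegrable _ _) hbound
      _ ≤ (∫ y in a..c, iterInt a g k y) + ∫ y in c..b, iterInt a g k y :=
        le_add_of_nonneg_left (iterInt_nonneg a (fun _ => abs_nonneg _) (k + 1) hac)
      _ = iterInt a g (k + 1) b :=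
        integral_add_adjacent_intervals (hgc.intervalIntegrable _ _) (hgc.intervalIntegrable _ _)

open scoped Classical in
theorem abs_eval_le_iterated_integral
    (k : ℕ) (hk : 1 ≤ k) (a b : ℝ) (hab : a < b) (P : Polynomial ℝ)
    (hroots : k ≤ Multiset.card (P.roots.filter (fun x => x ∈ Set.Ico a b))) :
    |P.eval b|
      ≤ iterInt a (fun y => |Polynomial.eval y (Polynomial.derivative^[k] P)|) k b :=
  abs_eval_le_iterInt_of_le_card_roots k a b P hroots
end
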